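/- arXiv:math/0503692 — 2 statements merged into one kernel-verified Lean document; each statement's English description precedes it below -/
import Mathlib

section
/- Let Φ be a reduced irreducible crystallographic root system in a finite-dimensional real inner product space V with base Δ, highest root θ, and root lattice Λ_r. For every positive integer k and every λ ∈ Λ_r which is dominant and satisfies 2(λ,θ)/(θ,θ) ≤ k, there exists a finite sequence λ = μ_0, μ_1, …, μ_m = 0 such that each μ_t lies in Λ_r, is dominant, satisfies 2(μ_t,θ)/(θ,θ) ≤ k, and μ_t − μ_{t+1} is a short root for every t < m. -/
open RealInnerProductSpace

variable {V : Type*} [NormedAddCommGroup V] [InnerProductSpace ℝ V] [FiniteDimensional ℝ V]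

/-- A reduced irreducible crystallographic root system in a finite-dimensional real
inner product space. -/
structure IsRootSystem (Φ : Set V) : Prop where
  finite : Φ.Finite
  ne_zero : (0 : V) ∉ Φ
  spans : Submodule.span ℝ Φ = ⊤
  crystallographic : ∀ α ∈ Φ, ∀ β ∈ Φ, ∃ n : ℤ, 2 * ⟪β, α⟫ / ⟪α, α⟫ = (n : ℝ)
  reflect_mem : ∀ α ∈ Φ, ∀ β ∈ Φ, β - (2 * ⟪β, α⟫ / ⟪α, α⟫) • α ∈ Φ
  reduced : ∀ α ∈ Φ, ∀ t : ℝ, t • α ∈ Φ → t = 1 ∨ t = -1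
  irreducible : ∀ S : Set V, S ⊆ Φ → (∀ α ∈ S, ∀ β ∈ Φ, β ∉ S → ⟪α, β⟫ = 0) →
    S = ∅ ∨ S = Φ

/-- The family `α` is a base (system of simple roots) for the root system `Φ`. -/
structure IsBase (Φ : Set V) {r : ℕ} (α : Fin r → V) : Prop where
  mem : ∀ i, α i ∈ Φ
  indep : LinearIndependent ℝ α
  gen : ∀ β ∈ Φ, ∃ c : Fin r → ℤ, ((∀ i, 0 ≤ c i) ∨ (∀ i, c i ≤ 0)) ∧
    β = ∑ i, (c i : ℝ) • α i

/-- A vector is dominant if its inner product with every simple root is nonnegative. -/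
def IsDominant {r : ℕ} (α : Fin r → V) (x : V) : Prop := ∀ i, 0 ≤ ⟪x, α i⟫

/-- A short root: a root of minimal length. -/
def IsShortRoot (Φ : Set V) (x : V) : Prop := x ∈ Φ ∧ ∀ β ∈ Φ, ‖x‖ ≤ ‖β‖

/-- A long root: a root of maximal length. -/
def IsLongRoot (Φ : Set V) (x : V) : Prop := x ∈ Φ ∧ ∀ β ∈ Φ, ‖β‖ ≤ ‖x‖

/-- The highest root: the unique dominant long root. -/
def IsHighestRoot (Φ : Set V) {r : ℕ} (α : Fin r → V) (θ : V) : Prop :=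
  IsLongRoot Φ θ ∧ IsDominant α θ

set_option linter.unusedSectionVars false

lemma IsRootSystem.inner_pos {Φ : Set V} (hΦ : IsRootSystem Φ) {a : V} (ha : a ∈ Φ) :
    0 < ⟪a, a⟫ := by
  have : a ≠ 0 := fun h => hΦ.ne_zero (h ▸ ha)
  exact real_inner_self_pos.mpr this

lemma IsShortRoot.inner_le {Φ : Set V} {a b : V} (ha : IsShortRoot Φ a) (hb : b ∈ Φ) :
    ⟪a, a⟫ ≤ ⟪b, b⟫ := by
  rw [real_inner_self_eq_norm_sq, real_inner_self_eq_norm_sq]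
  have := ha.2 b hb
  gcongr

lemma IsShortRoot.of_inner_le {Φ : Set V} {a b : V} (ha : IsShortRoot Φ a) (hb : b ∈ Φ)
    (h : ⟪b, b⟫ ≤ ⟪a, a⟫) : IsShortRoot Φ b := by
  refine ⟨hb, fun c hc => le_trans ?_ (ha.2 c hc)⟩
  rw [real_inner_self_eq_norm_sq, real_inner_self_eq_norm_sq] at h
  exact le_of_sq_le_sq h (norm_nonneg _)

lemma inner_reflect (x a : V) (n : ℝ) (h : 2 * ⟪x, a⟫ = n * ⟪a, a⟫) :
    ⟪x - n • a, x - n • a⟫ = ⟪x, x⟫ := by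
  simp only [inner_sub_left, inner_sub_right, inner_smul_left, inner_smul_right,
    real_inner_comm x a, RCLike.conj_to_real]
  linear_combination (-n) * h

lemma IsRootSystem.cartan {Φ : Set V} (hΦ : IsRootSystem Φ) {a b : V} (ha : a ∈ Φ) (hb : b ∈ Φ) :
    ∃ n : ℤ, 2 * ⟪b, a⟫ = n * ⟪a, a⟫ ∧ b - (n : ℝ) • a ∈ Φ := by
  obtain ⟨n, hn⟩ := hΦ.crystallographic a ha b hb
  have h := hΦ.reflect_mem a ha b hb
  rw [hn] at h
  refine ⟨n, ?_, h⟩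
  have := hΦ.inner_pos ha
  field_simp at hn
  linarith

lemma IsRootSystem.neg_mem {Φ : Set V} (hΦ : IsRootSystem Φ) {a : V} (ha : a ∈ Φ) : -a ∈ Φ := by
  have h := hΦ.reflect_mem a ha a ha
  have h0 := hΦ.inner_pos ha
  rw [mul_div_assoc, div_self h0.ne', mul_one, two_smul] at h
  simpa using h

lemma IsShortRoot.reflect {Φ : Set V} {a x : V} (hx : IsShortRoot Φ x) (n : ℝ)
    (h : 2 * ⟪x, a⟫ = n * ⟪a, a⟫) (hm : x - n • a ∈ Φ) : IsShortRoot Φ (x - n • a) :=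
  hx.of_inner_le hm (inner_reflect x a n h).le

lemma IsShortRoot.neg {Φ : Set V} (hΦ : IsRootSystem Φ) {x : V} (hx : IsShortRoot Φ x) :
    IsShortRoot Φ (-x) :=
  hx.of_inner_le (hΦ.neg_mem hx.1) (by simp)

/-- Two short roots at an obtuse angle add up to a short root or zero. -/
lemma short_add {Φ : Set V} (hΦ : IsRootSystem Φ) {a b : V} (ha : IsShortRoot Φ a)
    (hb : IsShortRoot Φ b) (h : ⟪a, b⟫ < 0) : IsShortRoot Φ (a + b) ∨ a + b = 0 := by
  obtain ⟨n, hn, hm⟩ := hΦ.cartan hb.1 ha.1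
  have hb0 := hΦ.inner_pos hb.1
  have hab : ⟪a, a⟫ = ⟪b, b⟫ := le_antisymm (ha.inner_le hb.1) (hb.inner_le ha.1)
  have hn0 : (n : ℝ) < 0 := by
    by_contra hc
    push Not at hc
    nlinarith
  have hn0' : n < 0 := by exact_mod_cast hn0
  rcases (show n = -1 ∨ n ≤ -2 by omega) with h1 | h1
  · left
    have := ha.reflect n hn hm
    simpa [h1] using this
  · right
    have h1' : (n : ℝ) ≤ -2 := by exact_mod_cast h1
    rw [← real_inner_self_nonpos]
    simp only [inner_add_left, inner_add_right, real_inner_comm a b]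
    nlinarith

/-- A root not orthogonal to a short root is in the span of the short roots. -/
lemma mem_span_of_not_orth {Φ : Set V} (hΦ : IsRootSystem Φ) {g b : V} (hg : IsShortRoot Φ g)
    (hb : b ∈ Φ) (h : ⟪g, b⟫ ≠ 0) : b ∈ Submodule.span ℤ {x | IsShortRoot Φ x} := by
  have hb0 := hΦ.inner_pos hb
  rcases (hg.inner_le hb).lt_or_eq with hlt | heq
  · obtain ⟨n, hn, hm⟩ := hΦ.cartan hb hg.1
    have hr := hg.reflect n hn hm
    have hcs := real_inner_mul_inner_self_le g b
    have hn0 : n ≠ 0 := by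
      rintro rfl
      apply h
      simpa using hn
    have hn4 : (n : ℝ) * n < 4 := by
      have : (n * ⟪b, b⟫) * (n * ⟪b, b⟫) < 4 * (⟪b, b⟫ * ⟪b, b⟫) := by
        rw [← hn]
        nlinarith
      by_contra hc
      push Not at hc
      nlinarith [mul_pos hb0 hb0]
    have hn4' : n * n < 4 := by exact_mod_cast hn4
    have h1 : n < 2 := by nlinarith
    have h2 : -2 < n := by nlinarith
    have hgs : g ∈ Submodule.span ℤ {x | IsShortRoot Φ x} := Submodule.subset_span hg
    have hrs : g - (n : ℝ) • b ∈ Submodule.span ℤ {x | IsShortRoot Φ x} :=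
      Submodule.subset_span hr
    rcases (show n = 1 ∨ n = -1 by omega) with h3 | h3
    · have := sub_mem hgs hrs
      simpa [h3] using this
    · have := sub_mem hrs hgs
      simpa [h3] using this
  · exact Submodule.subset_span (hg.of_inner_le hb heq.ge)

lemma span_short {Φ : Set V} (hΦ : IsRootSystem Φ) {θ : V} (hθ : θ ∈ Φ) :
    Submodule.span ℤ Φ ≤ Submodule.span ℤ {x | IsShortRoot Φ x} := by
  rw [Submodule.span_le]
  obtain ⟨g, hg, hgm⟩ := Set.exists_min_image Φ (fun x => ‖x‖) hΦ.finite ⟨θ, hθ⟩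
  have hgs : IsShortRoot Φ g := ⟨hg, hgm⟩
  have := hΦ.irreducible {x | x ∈ Φ ∧ x ∈ Submodule.span ℤ {x | IsShortRoot Φ x}}
    (fun x hx => hx.1) (by
      rintro a ⟨hh, ha⟩ b hb hbn
      have hbn' : b ∉ Submodule.span ℤ {x | IsShortRoot Φ x} := fun h => hbn ⟨hb, h⟩
      clear hh
      induction ha using Submodule.span_induction with
      | mem x hx =>
        by_contra hc
        exact hbn' (mem_span_of_not_orth hΦ hx hb hc)
      | zero => simp
      | add x y _ _ hx hy => rw [inner_add_left, hx, hy, add_zero]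
      | smul n x _ hx =>
        rw [← Int.cast_smul_eq_zsmul ℝ, inner_smul_left, hx, mul_zero])
  rcases this with h | h
  · exfalso
    have : g ∈ (∅ : Set V) := h ▸ ⟨hg, Submodule.subset_span hgs⟩
    exact this
  · intro x hx
    rw [← h] at hx
    exact hx.2

lemma inner_list_sum_nonneg (b : V) (l : List V) (h : ∀ c ∈ l, 0 ≤ ⟪b, c⟫) :
    0 ≤ ⟪b, l.sum⟫ := by
  induction l with
  | nil => simp
  | cons a l ih =>
    rw [List.sum_cons, inner_add_right]
    have h1 := h a (by simp)
    have h2 := ih (fun c hc => h c (by simp [hc]))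
    linarith

lemma exists_short_of_list {Φ : Set V} (hΦ : IsRootSystem Φ) (n : ℕ) :
    ∀ l : List V, l.length ≤ n → (∀ x ∈ l, IsShortRoot Φ x) → l.sum ≠ 0 →
      ∃ b, IsShortRoot Φ b ∧ ⟪b, b⟫ ≤ ⟪l.sum, b⟫ := by
  induction n with
  | zero =>
    intro l hl _ h0
    rw [Nat.le_zero, List.length_eq_zero_iff] at hl
    simp [hl] at h0
  | succ n ih =>
    intro l hl hs h0
    rcases l with _ | ⟨b, l⟩
    · simp at h0
    by_cases hc : ∀ c ∈ l, 0 ≤ ⟪b, c⟫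
    · refine ⟨b, hs b (by simp), ?_⟩
      have := inner_list_sum_nonneg b l hc
      rw [List.sum_cons, inner_add_left, real_inner_comm b l.sum]
      linarith
    · push Not at hc
      obtain ⟨c, hcl, hc⟩ := hc
      classical
      have hsum : l.sum = c + (l.erase c).sum := by
        rw [(List.perm_cons_erase hcl).sum_eq, List.sum_cons]
      have hlen : (l.erase c).length + 1 = l.length := List.length_erase_add_one hcl
      have hmem : ∀ x ∈ l.erase c, IsShortRoot Φ x := fun x hx =>
        hs x (by simp [List.mem_of_mem_erase hx])
      simp only [List.length_cons] at hl
      rcases short_add hΦ (hs b (by simp)) (hs c (by simp [hcl])) hc with h | h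
      · have he : (b :: l).sum = ((b + c) :: l.erase c).sum := by
          simp only [List.sum_cons, hsum, add_assoc]
        rw [he] at h0 ⊢
        refine ih _ (by simp; omega) ?_ h0
        intro x hx
        rcases List.mem_cons.mp hx with rfl | hx
        · exact h
        · exact hmem x hx
      · have he : (b :: l).sum = (l.erase c).sum := by
          rw [List.sum_cons, hsum, ← add_assoc, h, zero_add]
        rw [he] at h0 ⊢
        exact ih _ (by omega) hmem h0

lemma exists_list {Φ : Set V} (hΦ : IsRootSystem Φ) {x : V}
    (hx : x ∈ Submodule.span ℤ {x | IsShortRoot Φ x}) :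
    ∃ l : List V, (∀ y ∈ l, IsShortRoot Φ y) ∧ l.sum = x := by
  have hx' : x ∈ AddSubgroup.closure {x | IsShortRoot Φ x} := by
    rw [← Submodule.span_int_eq_addSubgroupClosure]
    exact hx
  clear hx
  induction hx' using AddSubgroup.closure_induction with
  | mem x h => exact ⟨[x], by simpa using h, by simp⟩
  | zero => exact ⟨[], by simp, by simp⟩
  | add x y _ _ hx hy =>
    obtain ⟨l, hl, rfl⟩ := hx
    obtain ⟨l', hl', rfl⟩ := hy
    refine ⟨l ++ l', fun y hy => ?_, by simp⟩
    rcases List.mem_append.mp hy with h | h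
    · exact hl y h
    · exact hl' y h
  | neg x _ hx =>
    obtain ⟨l, hl, rfl⟩ := hx
    refine ⟨l.map (fun y => -y), fun y hy => ?_, (List.sum_neg l).symm⟩
    obtain ⟨z, hz, rfl⟩ := List.mem_map.mp hy
    exact (hl z hz).neg hΦ

lemma exists_short {Φ : Set V} (hΦ : IsRootSystem Φ) {x : V}
    (hx : x ∈ Submodule.span ℤ {x | IsShortRoot Φ x}) (h0 : x ≠ 0) :
    ∃ b, IsShortRoot Φ b ∧ ⟪b, b⟫ ≤ ⟪x, b⟫ := by
  obtain ⟨l, hl, rfl⟩ := exists_list hΦ hx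
  exact exists_short_of_list hΦ l.length l le_rfl hl h0

lemma span_integral {Φ : Set V} (hΦ : IsRootSystem Φ) {x a : V} (hx : x ∈ Submodule.span ℤ Φ)
    (ha : a ∈ Φ) : ∃ n : ℤ, 2 * ⟪x, a⟫ = n * ⟪a, a⟫ := by
  induction hx using Submodule.span_induction with
  | mem x hx =>
    obtain ⟨n, hn, _⟩ := hΦ.cartan ha hx
    exact ⟨n, hn⟩
  | zero => exact ⟨0, by simp⟩
  | add x y _ _ hx hy =>
    obtain ⟨n, hn⟩ := hx
    obtain ⟨m, hm⟩ := hy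
    exact ⟨n + m, by rw [inner_add_left]; push_cast; linarith⟩
  | smul k x _ hx =>
    obtain ⟨n, hn⟩ := hx
    refine ⟨k * n, ?_⟩
    rw [← Int.cast_smul_eq_zsmul ℝ, inner_smul_left]
    simp only [RCLike.conj_to_real]
    push_cast
    linear_combination (k : ℝ) * hn

lemma span_short_integral {Φ : Set V} (hΦ : IsRootSystem Φ) {x y g : V}
    (hx : x ∈ Submodule.span ℤ Φ) (hg : IsShortRoot Φ g)
    (hy : y ∈ Submodule.span ℤ {x | IsShortRoot Φ x}) :
    ∃ n : ℤ, 2 * ⟪x, y⟫ = n * ⟪g, g⟫ := by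
  induction hy using Submodule.span_induction with
  | mem y hy =>
    obtain ⟨n, hn⟩ := span_integral hΦ hx hy.1
    exact ⟨n, by rw [hn, le_antisymm (hy.inner_le hg.1) (hg.inner_le hy.1)]⟩
  | zero => exact ⟨0, by simp⟩
  | add x y _ _ hx hy =>
    obtain ⟨n, hn⟩ := hx
    obtain ⟨m, hm⟩ := hy
    exact ⟨n + m, by rw [inner_add_right]; push_cast; linarith⟩
  | smul k x _ hx =>
    obtain ⟨n, hn⟩ := hx
    refine ⟨k * n, ?_⟩
    rw [← Int.cast_smul_eq_zsmul ℝ, inner_smul_right]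
    push_cast
    linear_combination (k : ℝ) * hn

lemma exists_height {Φ : Set V} (hΦ : IsRootSystem Φ) {r : ℕ} {α : Fin r → V}
    (hbase : IsBase Φ α) : ∃ f : V →ₗ[ℝ] ℝ, ∀ i, f (α i) = 1 := by
  have hsp : ⊤ ≤ Submodule.span ℝ (Set.range α) := by
    rw [← hΦ.spans, Submodule.span_le]
    intro b hb
    obtain ⟨c, _, rfl⟩ := hbase.gen b hb
    exact Submodule.sum_mem _ fun i _ => Submodule.smul_mem _ _ (Submodule.subset_span ⟨i, rfl⟩)
  let B := Module.Basis.mk hbase.indep hsp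
  refine ⟨B.constr ℝ (fun _ => (1 : ℝ)), fun i => ?_⟩
  have := B.constr_basis ℝ (fun _ => (1 : ℝ)) i
  rwa [Module.Basis.mk_apply] at this

/-- The main step: subtract a short root, staying dominant and decreasing the norm. -/
lemma exists_step {Φ : Set V} (hΦ : IsRootSystem Φ) {r : ℕ} {α : Fin r → V}
    (hbase : IsBase Φ α) {x : V} (hx : x ∈ Submodule.span ℤ Φ) (hdom : IsDominant α x)
    (hxs : x ∈ Submodule.span ℤ {x | IsShortRoot Φ x}) (h0 : x ≠ 0) :
    ∃ g, IsShortRoot Φ g ∧ ⟪x - g, x - g⟫ < ⟪x, x⟫ ∧ IsDominant α (x - g) := by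
  obtain ⟨f, hf⟩ := exists_height hΦ hbase
  obtain ⟨b, hb, hbx⟩ := exists_short hΦ hxs h0
  have hb1 : ⟪x - b, x - b⟫ < ⟪x, x⟫ := by
    simp only [inner_sub_left, inner_sub_right, real_inner_comm x b]
    have := hΦ.inner_pos hb.1
    linarith
  obtain ⟨g, ⟨hg, hgx⟩, hmin⟩ := Set.exists_min_image
    {g | IsShortRoot Φ g ∧ ⟪x - g, x - g⟫ < ⟪x, x⟫} f
    (hΦ.finite.subset fun g hg => hg.1.1) ⟨b, hb, hb1⟩
  refine ⟨g, hg, hgx, fun i => ?_⟩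
  by_contra hneg
  push Not at hneg
  have ha := hbase.mem i
  have ha0 := hΦ.inner_pos ha
  obtain ⟨m, hm⟩ := span_integral hΦ (sub_mem hx (Submodule.subset_span hg.1)) ha
  obtain ⟨p, hp, hpm⟩ := hΦ.cartan ha hg.1
  have hrn := inner_reflect (x - g) (α i) m hm
  have hm0 : (m : ℝ) < 0 := by
    by_contra hc
    push Not at hc
    nlinarith
  have hmp : (0 : ℝ) ≤ m + p := by
    have h1 := hdom i
    rw [inner_sub_left] at hm
    by_contra hc
    push Not at hc
    nlinarith
  have hm0' : m < 0 := by exact_mod_cast hm0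
  have hmp' : 0 ≤ m + p := by exact_mod_cast hmp
  rcases hmp'.eq_or_lt with h | h
  · have hpe : p = -m := by omega
    have hs := hg.reflect p hp hpm
    have hle := hmin (g - (p : ℝ) • α i) ⟨hs, by
      have : x - (g - (p : ℝ) • α i) = x - g - (m : ℝ) • α i := by
        rw [hpe]; push_cast; module
      rw [this, hrn]; exact hgx⟩
    rw [map_sub, map_smul, hf, hpe] at hle
    push_cast at hle
    simp only [smul_eq_mul] at hle
    linarith
  · have hp2 : (2 : ℝ) ≤ p := by
      have : 2 ≤ p := by omega
      exact_mod_cast this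
    have hga : g - α i = 0 := by
      rw [← real_inner_self_nonpos]
      simp only [inner_sub_left, inner_sub_right, real_inner_comm g (α i)]
      have := hg.inner_le ha
      nlinarith
    have hga : g = α i := sub_eq_zero.mp hga
    have hp2' : (p : ℝ) = 2 := by
      rw [hga] at hp
      exact (mul_right_cancel₀ ha0.ne' hp).symm
    have hp2'' : p = 2 := by exact_mod_cast hp2'
    have hm1 : m = -1 := by omega
    rw [hm1, hga] at hrn
    rw [hga, ← hrn] at hgx
    simp at hgx

/-- For every positive integer `k` and every dominant element `λ` of the root lattice of
level at most `k`, there is a chain `λ = μ_0, μ_1, …, μ_m = 0` of dominant root-lattice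
elements of level at most `k` whose consecutive differences are short roots. -/
theorem stmt0 (Φ : Set V) (hΦ : IsRootSystem Φ) {r : ℕ} (α : Fin r → V)
    (hbase : IsBase Φ α) (θ : V) (hθ : IsHighestRoot Φ α θ) (k : ℕ) (hk : 0 < k)
    (lam : V) (hmem : lam ∈ Submodule.span ℤ Φ) (hdom : IsDominant α lam)
    (hlev : 2 * ⟪lam, θ⟫ / ⟪θ, θ⟫ ≤ (k : ℝ)) :
    ∃ (m : ℕ) (μ : ℕ → V), μ 0 = lam ∧ μ m = 0 ∧
      (∀ t ≤ m, μ t ∈ Submodule.span ℤ Φ ∧ IsDominant α (μ t) ∧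
        2 * ⟪μ t, θ⟫ / ⟪θ, θ⟫ ≤ (k : ℝ)) ∧
      (∀ t < m, IsShortRoot Φ (μ t - μ (t + 1))) := by
  have hθΦ := hθ.1.1
  have hle := span_short hΦ hθΦ
  obtain ⟨s, hs, hsm⟩ := Set.exists_min_image Φ (fun x => ‖x‖) hΦ.finite ⟨θ, hθΦ⟩
  have hss : IsShortRoot Φ s := ⟨hs, hsm⟩
  have hs0 := hΦ.inner_pos hs
  have hθ0 := hΦ.inner_pos hθΦ
  have key : ∀ N : ℕ, ∀ x : V, 2 * ⟪x, x⟫ ≤ N * ⟪s, s⟫ → x ∈ Submodule.span ℤ Φ →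
      IsDominant α x → 2 * ⟪x, θ⟫ / ⟪θ, θ⟫ ≤ (k : ℝ) →
      ∃ (m : ℕ) (μ : ℕ → V), μ 0 = x ∧ μ m = 0 ∧
      (∀ t ≤ m, μ t ∈ Submodule.span ℤ Φ ∧ IsDominant α (μ t) ∧
        2 * ⟪μ t, θ⟫ / ⟪θ, θ⟫ ≤ (k : ℝ)) ∧
      (∀ t < m, IsShortRoot Φ (μ t - μ (t + 1))) := by
    intro N
    induction N with
    | zero =>
      intro x hN hx hd hl
      have hx0 : x = 0 := by
        rw [← real_inner_self_nonpos]
        simp only [Nat.cast_zero, zero_mul] at hN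
        linarith
      exact ⟨0, fun _ => x, rfl, hx0, fun _ _ => ⟨hx, hd, hl⟩, fun t ht => by omega⟩
    | succ N ih =>
      intro x hN hx hd hl
      by_cases hx0 : x = 0
      · exact ⟨0, fun _ => x, rfl, hx0, fun _ _ => ⟨hx, hd, hl⟩, fun t ht => by omega⟩
      obtain ⟨g, hg, hgx, hgd⟩ := exists_step hΦ hbase hx hd (hle hx) hx0
      have hxg : x - g ∈ Submodule.span ℤ Φ := sub_mem hx (Submodule.subset_span hg.1)
      have hN' : 2 * ⟪x - g, x - g⟫ ≤ N * ⟪s, s⟫ := by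
        obtain ⟨n, hn⟩ := span_short_integral hΦ hxg hss (hle hxg)
        rw [hn]
        have h1 : (n : ℝ) < ((N + 1 : ℕ) : ℝ) := by
          by_contra hc
          push Not at hc
          nlinarith
        have h2 : n < ((N + 1 : ℕ) : ℤ) := by exact_mod_cast h1
        have h3 : n ≤ (N : ℤ) := by push_cast at h2; omega
        have h4 : (n : ℝ) ≤ (N : ℝ) := by exact_mod_cast h3
        gcongr
      have hgθ : 0 ≤ ⟪g, θ⟫ := by
        have hxgpos : 0 < ⟪x, g⟫ := by
          simp only [inner_sub_left, inner_sub_right, real_inner_comm x g] at hgx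
          have := hΦ.inner_pos hg.1
          linarith
        obtain ⟨c, hc, hge⟩ := hbase.gen g hg.1
        rcases hc with hc | hc
        · rw [hge, sum_inner]
          refine Finset.sum_nonneg fun i _ => ?_
          rw [inner_smul_left, real_inner_comm]
          have h1 := hθ.2 i
          have h2 : (0 : ℝ) ≤ c i := by exact_mod_cast hc i
          exact mul_nonneg h2 h1
        · exfalso
          rw [hge, inner_sum] at hxgpos
          refine absurd hxgpos (not_lt.mpr (Finset.sum_nonpos fun i _ => ?_))
          rw [inner_smul_right]
          have h2 : (c i : ℝ) ≤ 0 := by exact_mod_cast hc i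
          exact mul_nonpos_of_nonpos_of_nonneg h2 (hd i)
      have hl' : 2 * ⟪x - g, θ⟫ / ⟪θ, θ⟫ ≤ (k : ℝ) := by
        refine le_trans ?_ hl
        rw [inner_sub_left]
        gcongr
        linarith
      obtain ⟨m, μ, h0, hm, hall, hdiff⟩ := ih (x - g) hN' hxg hgd hl'
      refine ⟨m + 1, fun t => if t = 0 then x else μ (t - 1), by simp, by simpa using hm, ?_, ?_⟩
      · rintro (_ | t) ht
        · exact ⟨hx, hd, hl⟩
        · exact hall t (by omega)
      · rintro (_ | t) ht
        · simpa [h0] using hg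
        · simpa using hdiff t (by omega)
  obtain ⟨N, hN⟩ := exists_nat_ge (2 * ⟪lam, lam⟫ / ⟪s, s⟫)
  refine key N lam ?_ hmem hdom hlev
  rwa [div_le_iff₀ hs0] at hN
end

section
/- In the root system E_6, neither 3λ_1 nor 3λ_6 can be written as the sum of two roots of E_6, even though both lie in the root lattice. -/
open RealInnerProductSpace

/-- The Gram matrix of the simple roots of `E_6` (Bourbaki numbering, zero-based),
normalized so that `(θ,θ) = 2`, i.e. all roots have squared length `2`. -/
def e6Gram : Matrix (Fin 6) (Fin 6) ℝ :=
  !![ 2,  0, -1,  0,  0,  0;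
      0,  2,  0, -1,  0,  0;
     -1,  0,  2, -1,  0,  0;
      0, -1, -1,  2, -1,  0;
      0,  0,  0, -1,  2, -1;
      0,  0,  0,  0, -1,  2]

/-- A vector orthogonal to six vectors with Gram matrix `e6Gram` in a 6-dimensional space is zero. -/
theorem e6_orth_zero {V : Type*} [NormedAddCommGroup V] [InnerProductSpace ℝ V]
    [FiniteDimensional ℝ V] (hdim : Module.finrank ℝ V = 6)
    (a : Fin 6 → V) (hGram : ∀ i j, ⟪a i, a j⟫ = e6Gram i j)
    (d : V) (hd : ∀ j, ⟪d, a j⟫ = 0) : d = 0 := by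
  have hli : LinearIndependent ℝ a := by
    rw [Fintype.linearIndependent_iff]
    intro g hg
    have h : ∀ j, ∑ i, g i * e6Gram i j = 0 := by
      intro j
      have h1 : ⟪∑ i, g i • a i, a j⟫ = 0 := by rw [hg, inner_zero_left]
      simpa only [sum_inner, real_inner_smul_left, hGram] using h1
    have h0 := h 0
    have h1 := h 1
    have h2 := h 2
    have h3 := h 3
    have h4 := h 4
    have h5 := h 5
    simp [Fin.sum_univ_six, e6Gram] at h0 h1 h2 h3 h4 h5
    intro i
    fin_cases i <;> simp <;> linarith
  have hspan : Submodule.span ℝ (Set.range a) = ⊤ :=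
    hli.span_eq_top_of_card_eq_finrank' (by simp [hdim])
  have hmem : d ∈ Submodule.span ℝ (Set.range a) := by rw [hspan]; trivial
  have : ∀ x ∈ Submodule.span ℝ (Set.range a), ⟪d, x⟫ = 0 := by
    intro x hx
    induction hx using Submodule.span_induction with
    | mem x hx => obtain ⟨j, rfl⟩ := hx; exact hd j
    | zero => exact inner_zero_right _
    | add x y _ _ hx hy => rw [inner_add_right, hx, hy, add_zero]
    | smul c x _ hx => rw [real_inner_smul_right, hx, mul_zero]
  exact inner_self_eq_zero.mp (this d hmem)

/-- If `3 l` is an integer combination of simple roots with `(3l, 3l) = 12`, the claims hold. -/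
theorem e6_no_sum {V : Type*} [NormedAddCommGroup V] [InnerProductSpace ℝ V]
    (v x y : V) (hv : ⟪v, v⟫ = 12) (hx : ⟪x, x⟫ = 2) (hy : ⟪y, y⟫ = 2) : v ≠ x + y := by
  rintro rfl
  have h := real_inner_self_nonneg (x := x - y)
  rw [real_inner_sub_sub_self] at h
  rw [real_inner_add_add_self] at hv
  linarith

/-- Expansion of `3 l` in the simple roots. -/
theorem e6_expand {V : Type*} [NormedAddCommGroup V] [InnerProductSpace ℝ V]
    [FiniteDimensional ℝ V] (hdim : Module.finrank ℝ V = 6)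
    (a : Fin 6 → V) (hGram : ∀ i j, ⟪a i, a j⟫ = e6Gram i j)
    (l : V) (k : Fin 6) (hl : ∀ j, ⟪l, a j⟫ = if k = j then 1 else 0)
    (c : Fin 6 → ℤ) (hc : ∀ j, ∑ i, (c i : ℝ) * e6Gram i j = if k = j then 3 else 0)
    (hck : c k = 4) :
    (3 : ℝ) • l ∈ Submodule.span ℤ (Set.range a) ∧ ⟪(3 : ℝ) • l, (3 : ℝ) • l⟫ = 12 := by
  have key : (3 : ℝ) • l = ∑ i, (c i : ℝ) • a i := by
    rw [← sub_eq_zero]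
    apply e6_orth_zero hdim a hGram
    intro j
    rw [inner_sub_left, sum_inner]
    simp only [real_inner_smul_left, hGram, hc, hl]
    split_ifs <;> norm_num
  constructor
  · rw [key]
    refine Submodule.sum_mem _ fun i _ => ?_
    rw [Int.cast_smul_eq_zsmul]
    exact Submodule.smul_mem _ _ (Submodule.subset_span ⟨i, rfl⟩)
  · rw [real_inner_smul_left, key, inner_sum]
    simp only [real_inner_smul_right, hl]
    simp [hck]
    norm_num

/-- In the simply-laced root system `E_6`, the roots are exactly the vectors of squared
length `2` in the root lattice (the `ℤ`-span of the simple roots).  Neither `3λ_1` nor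
`3λ_6` can be written as a sum of two roots, although both lie in the root lattice. -/
theorem stmt11 {V : Type*} [NormedAddCommGroup V] [InnerProductSpace ℝ V]
    [FiniteDimensional ℝ V] (hdim : Module.finrank ℝ V = 6)
    (a : Fin 6 → V) (hGram : ∀ i j, ⟪a i, a j⟫ = e6Gram i j)
    (lam : Fin 6 → V)
    (hlam : ∀ i j, ⟪lam i, a j⟫ = if i = j then 1 else 0) :
    let IsRoot : V → Prop := fun x => x ∈ Submodule.span ℤ (Set.range a) ∧ ⟪x, x⟫ = 2
    ((3 : ℝ) • lam 0 ∈ Submodule.span ℤ (Set.range a) ∧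
      (3 : ℝ) • lam 5 ∈ Submodule.span ℤ (Set.range a)) ∧
    (¬ ∃ x y : V, IsRoot x ∧ IsRoot y ∧ (3 : ℝ) • lam 0 = x + y) ∧
    (¬ ∃ x y : V, IsRoot x ∧ IsRoot y ∧ (3 : ℝ) • lam 5 = x + y) := by
  intro IsRoot
  have A := e6_expand hdim a hGram (lam 0) 0 (hlam 0) ![4, 3, 5, 6, 4, 2]
    (by intro j; fin_cases j <;> simp [Fin.sum_univ_six, e6Gram] <;> norm_num) (by simp)
  have B := e6_expand hdim a hGram (lam 5) 5 (hlam 5) ![2, 3, 4, 6, 5, 4]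
    (by intro j; fin_cases j <;> simp [Fin.sum_univ_six, e6Gram] <;> norm_num) (by simp)
  refine ⟨⟨A.1, B.1⟩, ?_, ?_⟩
  · rintro ⟨x, y, hx, hy, h⟩
    exact e6_no_sum _ x y A.2 hx.2 hy.2 h
  · rintro ⟨x, y, hx, hy, h⟩
    exact e6_no_sum _ x y B.2 hx.2 hy.2 h
end
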